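/- Let ν₁, …, ν_n be probability measures on ℝ with finite second moments. Define q̄(α) = (1/n) Σᵢ F_{νᵢ}⁻(α) for α ∈ (0,1), and let ν̄ be the pushforward of Lebesgue measure restricted to (0,1) by q̄. Then: (i) ν̄ is a probability measure on ℝ with finite second moment whose quantile function satisfies F_{ν̄}⁻(α) = q̄(α) for Lebesgue-almost every α ∈ (0,1); and (ii) ν̄ is a Wasserstein barycenter of ν₁, …, ν_n, i.e. for every probability measure μ on ℝ with finite second moment, (1/n) Σᵢ d_W²(νᵢ, ν̄) ≤ (1/n) Σᵢ d_W²(νᵢ, μ). -/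

import Mathlib

open MeasureTheory Set

/-- Cumulative distribution function of a measure on `ℝ`. -/
noncomputable def cdf (μ : Measure ℝ) (x : ℝ) : ℝ := (μ (Iic x)).toReal

/-- Quantile (generalized inverse cdf) of a measure on `ℝ`. -/
noncomputable def quantile (μ : Measure ℝ) (p : ℝ) : ℝ := sInf {x : ℝ | p ≤ cdf μ x}

/-- Squared 2-Wasserstein distance between measures on `ℝ`, via quantile functions. -/
noncomputable def W2sq (μ ν : Measure ℝ) : ℝ :=
  ∫ α in Ioo (0:ℝ) 1, (quantile μ α - quantile ν α) ^ 2

open Filter Topology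

lemma isLeast_quantile (μ : Measure ℝ) [IsProbabilityMeasure μ] {p : ℝ} (hp : p ∈ Ioo (0:ℝ) 1) :
    IsLeast {x : ℝ | p ≤ cdf μ x} (quantile μ p) := by
  have hcdf : ∀ x, cdf μ x = ProbabilityTheory.cdf μ x := fun x =>
    (ProbabilityTheory.cdf_eq_real μ x).symm
  have hne : {x : ℝ | p ≤ cdf μ x}.Nonempty := by
    obtain ⟨x, hx⟩ := ((ProbabilityTheory.tendsto_cdf_atTop μ).eventually_const_lt hp.2).exists
    exact ⟨x, by simpa [hcdf] using hx.le⟩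
  have hbdd : BddBelow {x : ℝ | p ≤ cdf μ x} := by
    obtain ⟨x, hx⟩ := ((ProbabilityTheory.tendsto_cdf_atBot μ).eventually_lt_const hp.1).exists
    refine ⟨x, fun y hy => ?_⟩
    by_contra! hlt
    have := ProbabilityTheory.monotone_cdf μ hlt.le
    simp only [mem_ofPred_eq, hcdf] at hy
    linarith
  refine ⟨?_, fun x hx => csInf_le hbdd hx⟩
  simp only [mem_ofPred_eq, hcdf]
  have hright := (ProbabilityTheory.cdf μ).right_continuous (quantile μ p)
  refine ge_of_tendsto (hright.mono_left (nhdsWithin_mono _ Ioi_subset_Ici_self)) ?_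
  filter_upwards [self_mem_nhdsWithin] with y hy
  obtain ⟨z, hz, hzy⟩ := (csInf_lt_iff hbdd hne).1 hy
  simp only [mem_ofPred_eq, hcdf] at hz
  exact hz.trans (ProbabilityTheory.monotone_cdf μ hzy.le)

lemma quantile_le_iff (μ : Measure ℝ) [IsProbabilityMeasure μ] {p : ℝ} (hp : p ∈ Ioo (0:ℝ) 1)
    (x : ℝ) : quantile μ p ≤ x ↔ p ≤ cdf μ x := by
  have h := isLeast_quantile μ hp
  refine ⟨fun hx => le_trans h.1 ?_, fun hx => h.2 hx⟩
  exact ENNReal.toReal_mono (measure_ne_top _ _) (measure_mono (Iic_subset_Iic.2 hx))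

lemma monotoneOn_quantile (μ : Measure ℝ) [IsProbabilityMeasure μ] :
    MonotoneOn (quantile μ) (Ioo 0 1) := fun _ ha _ hb hab =>
  (quantile_le_iff μ ha _).2 (hab.trans (isLeast_quantile μ hb).1)

lemma tendsto_quantile_left (μ : Measure ℝ) [IsProbabilityMeasure μ] {p : ℝ}
    (hp : p ∈ Ioo (0:ℝ) 1) : Tendsto (quantile μ) (𝓝[<] p) (𝓝 (quantile μ p)) := by
  refine tendsto_order.2 ⟨fun x hx => ?_, fun x hx => ?_⟩
  · have hlt : cdf μ x < p := by
      by_contra! h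
      exact hx.not_ge ((quantile_le_iff μ hp x).2 h)
    filter_upwards [Ioo_mem_nhdsLT hp.1, Ioo_mem_nhdsLT hlt] with b hb hb'
    by_contra! h
    exact hb'.1.not_ge ((quantile_le_iff μ ⟨hb.1, hb.2.trans hp.2⟩ x).1 h)
  · filter_upwards [Ioo_mem_nhdsLT hp.1] with b hb
    exact (monotoneOn_quantile μ ⟨hb.1, hb.2.trans hp.2⟩ hp hb.2.le).trans_lt hx

lemma aemeasurable_quantile (μ : Measure ℝ) [IsProbabilityMeasure μ] :
    AEMeasurable (quantile μ) (volume.restrict (Ioo (0:ℝ) 1)) :=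
  aemeasurable_restrict_of_monotoneOn measurableSet_Ioo (monotoneOn_quantile μ)

instance isProbabilityMeasure_volume_Ioo :
    IsProbabilityMeasure (volume.restrict (Ioo (0:ℝ) 1)) := ⟨by simp⟩

lemma map_quantile (μ : Measure ℝ) [IsProbabilityMeasure μ] :
    (volume.restrict (Ioo (0:ℝ) 1)).map (quantile μ) = μ := by
  have hm := aemeasurable_quantile μ
  have := Measure.isProbabilityMeasure_map hm
  refine Measure.ext_of_Iic _ _ fun x => ?_
  rw [Measure.map_apply_of_aemeasurable hm measurableSet_Iic,
    Measure.restrict_apply' measurableSet_Ioo]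
  have hset : quantile μ ⁻¹' Iic x ∩ Ioo 0 1 = Iic (cdf μ x) ∩ Ioo 0 1 := by
    ext p
    simp only [mem_inter_iff, mem_preimage, mem_Iic]
    exact and_congr_left fun hp => quantile_le_iff μ hp x
  have h1 : cdf μ x ≤ 1 := ENNReal.toReal_le_of_le_ofReal zero_le_one (by simpa using prob_le_one)
  have hae : (Iic (cdf μ x) ∩ Ioo 0 1 : Set ℝ) =ᵐ[volume] Ioc 0 (cdf μ x) := by
    have : (Iic (cdf μ x) ∩ Ioc 0 1 : Set ℝ) = Ioc 0 (cdf μ x) := by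
      ext p
      simp only [mem_inter_iff, mem_Iic, mem_Ioc]
      exact ⟨fun h => ⟨h.2.1, h.1⟩, fun h => ⟨h.2, h.1, h.2.trans h1⟩⟩
    rw [← this]
    exact (ae_eq_refl _).inter Ioo_ae_eq_Ioc
  rw [hset, measure_congr hae, Real.volume_Ioc, sub_zero]
  exact ENNReal.ofReal_toReal (measure_ne_top _ _)

lemma memLp_quantile (μ : Measure ℝ) [IsProbabilityMeasure μ]
    (hμ : Integrable (fun x => x ^ 2) μ) :
    MemLp (quantile μ) 2 (volume.restrict (Ioo (0:ℝ) 1)) := by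
  have hm := aemeasurable_quantile μ
  rw [memLp_two_iff_integrable_sq hm.aestronglyMeasurable]
  rw [← map_quantile μ] at hμ
  exact hμ.comp_aemeasurable hm

/-- A nondecreasing left-continuous function on `(0, 1)` is the quantile function of the
pushforward by it of Lebesgue measure on `(0, 1)`. -/
lemma quantile_map_of_monotoneOn {g : ℝ → ℝ} (hg : MonotoneOn g (Ioo 0 1))
    {p : ℝ} (hp : p ∈ Ioo (0:ℝ) 1) (hleft : Tendsto g (𝓝[<] p) (𝓝 (g p))) :
    quantile ((volume.restrict (Ioo (0:ℝ) 1)).map g) p = g p := by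
  have hm : AEMeasurable g (volume.restrict (Ioo (0:ℝ) 1)) :=
    aemeasurable_restrict_of_monotoneOn measurableSet_Ioo hg
  have hcdf : ∀ x, cdf ((volume.restrict (Ioo (0:ℝ) 1)).map g) x
      = volume.real (g ⁻¹' Iic x ∩ Ioo 0 1) := fun x => by
    rw [cdf, Measure.map_apply_of_aemeasurable hm measurableSet_Iic,
      Measure.restrict_apply' measurableSet_Ioo, measureReal_def]
  refine IsLeast.csInf_eq ⟨?_, fun x hx => ?_⟩
  · have hsub : Ioc 0 p ⊆ g ⁻¹' Iic (g p) ∩ Ioo 0 1 := fun b hb =>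
      have hb1 : b ∈ Ioo (0:ℝ) 1 := ⟨hb.1, hb.2.trans_lt hp.2⟩
      ⟨hg hb1 hp hb.2, hb1⟩
    have := measureReal_mono (μ := volume) hsub
      (measure_ne_top_of_subset inter_subset_right (by simp))
    simpa [hcdf, hp.1.le] using this
  · by_contra! hlt
    obtain ⟨b, hbx, hb⟩ :=
      ((hleft.eventually_const_lt hlt).and (Ioo_mem_nhdsLT hp.1)).exists
    have hsub : g ⁻¹' Iic x ∩ Ioo 0 1 ⊆ Ioc 0 b := fun c hc => by
      refine ⟨hc.2.1, ?_⟩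
      by_contra! hbc
      exact (hbx.trans_le (hg ⟨hb.1, hb.2.trans hp.2⟩ hc.2 hbc.le)).not_ge hc.1
    have := measureReal_mono (μ := volume) hsub (by simp)
    simp only [mem_ofPred_eq, hcdf] at hx
    simp [hb.1.le] at this
    linarith [hb.2]

/-- The arithmetic mean minimizes the sum of squared deviations. -/
lemma sum_sq_sub_mean_le {n : ℕ} (hn : 0 < n) (a : Fin n → ℝ) (y : ℝ) :
    ∑ i, (a i - (1 / n : ℝ) * ∑ j, a j) ^ 2 ≤ ∑ i, (a i - y) ^ 2 := by
  have hn' : (0:ℝ) < n := by exact_mod_cast hn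
  set m := (1 / n : ℝ) * ∑ j, a j with hmdef
  have hm : ∑ j, a j = n * m := by rw [hmdef]; field_simp
  have key : ∑ i, (a i - y) ^ 2 = ∑ i, (a i - m) ^ 2 + n * (m - y) ^ 2 := by
    have : ∀ i, (a i - y) ^ 2 = (a i - m) ^ 2 + (2 * (m - y) * a i + (y ^ 2 - m ^ 2)) :=
      fun i => by ring
    simp only [this, Finset.sum_add_distrib, ← Finset.mul_sum, hm]
    simp
    ring
  rw [key]
  exact le_add_of_nonneg_right (by positivity)

theorem stmt5 (n : ℕ) (hn : 0 < n) (ν : Fin n → Measure ℝ)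
    (hprob : ∀ i, IsProbabilityMeasure (ν i))
    (hmom : ∀ i, Integrable (fun x => x ^ 2) (ν i))
    (qbar : ℝ → ℝ) (hq : ∀ α, qbar α = (1 / n : ℝ) * ∑ i, quantile (ν i) α)
    (νbar : Measure ℝ) (hνbar : νbar = (volume.restrict (Ioo (0:ℝ) 1)).map qbar) :
    IsProbabilityMeasure νbar ∧
    Integrable (fun x => x ^ 2) νbar ∧
    (∀ᵐ α ∂(volume.restrict (Ioo (0:ℝ) 1)), quantile νbar α = qbar α) ∧
    (∀ μ : Measure ℝ, IsProbabilityMeasure μ → Integrable (fun x => x ^ 2) μ →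
      (1 / n : ℝ) * ∑ i, W2sq (ν i) νbar ≤ (1 / n : ℝ) * ∑ i, W2sq (ν i) μ) := by
  have hLp := fun i => memLp_quantile (ν i) (hmom i)
  obtain rfl : qbar = fun α => (1 / n : ℝ) * ∑ i, quantile (ν i) α := funext hq
  have hmono : MonotoneOn (fun α => (1 / n : ℝ) * ∑ i, quantile (ν i) α) (Ioo 0 1) :=
    fun a ha b hb hab => mul_le_mul_of_nonneg_left
      (Finset.sum_le_sum fun i _ => monotoneOn_quantile (ν i) ha hb hab) (by positivity)
  have hbarLp : MemLp (fun α => (1 / n : ℝ) * ∑ i, quantile (ν i) α) 2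
      (volume.restrict (Ioo (0:ℝ) 1)) :=
    (memLp_finsetSum Finset.univ fun i _ => hLp i).const_mul _
  have hm := hbarLp.aemeasurable
  have hquant : ∀ α ∈ Ioo (0:ℝ) 1,
      quantile νbar α = (1 / n : ℝ) * ∑ i, quantile (ν i) α := fun α hα => by
    rw [hνbar]
    exact quantile_map_of_monotoneOn hmono hα
      ((tendsto_finsetSum _ fun i _ => tendsto_quantile_left (ν i) hα).const_mul _)
  have hνprob : IsProbabilityMeasure νbar := hνbar ▸ Measure.isProbabilityMeasure_map hm
  have hνmom : Integrable (fun x => x ^ 2) νbar := by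
    rw [hνbar, integrable_map_measure (by fun_prop) hm]
    exact hbarLp.integrable_sq
  refine ⟨hνprob, hνmom, ae_restrict_of_forall_mem measurableSet_Ioo hquant,
    fun μ hμ hμmom => mul_le_mul_of_nonneg_left ?_ (by positivity)⟩
  have hint : ∀ ρ : Measure ℝ, IsProbabilityMeasure ρ → Integrable (fun x => x ^ 2) ρ → ∀ i,
      Integrable (fun α => (quantile (ν i) α - quantile ρ α) ^ 2)
        (volume.restrict (Ioo (0:ℝ) 1)) := fun ρ _ hρ i =>
    ((hLp i).sub (memLp_quantile ρ hρ)).integrable_sq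
  simp only [W2sq]
  rw [← integral_finsetSum _ fun i _ => hint νbar hνprob hνmom i,
    ← integral_finsetSum _ fun i _ => hint μ hμ hμmom i]
  refine setIntegral_mono_on (integrable_finsetSum _ fun i _ => hint νbar hνprob hνmom i)
    (integrable_finsetSum _ fun i _ => hint μ hμ hμmom i) measurableSet_Ioo fun α hα => ?_
  rw [hquant α hα]
  exact sum_sq_sub_mean_le hn _ _
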